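/- arXiv:1304.7012 — 3 statements merged into one kernel-verified Lean document; each statement's English description precedes it below -/
import Mathlib

section
/- For the plane curve X defined by x₁x₂ = 0 in 𝔸², the m-th jet scheme of X centered at the origin, i.e. Spec k[X_{1,1},…,X_{1,m},X_{2,1},…,X_{2,m}] / ({Σ_{1≤i≤n-1} X_{1,i}X_{2,n-i}}_{1≤n≤m}), has exactly m irreducible components, each of dimension m+1; in particular its dimension equals m+1 for every m ≥ 1. -/
/-!
STATEMENT 0: For the plane curve `X : x₁x₂ = 0` in `𝔸²`, the m-th jet scheme of `X`
centered at the origin has exactly `m` irreducible components, each of dimension `m+1`;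
in particular its dimension is `m+1` for every `m ≥ 1`.
-/

open MvPolynomial

/-- The coefficient `Fₙ⁰` of `tⁿ` in the Taylor expansion `f(∑_{i≥1} X̲ᵢ tⁱ)`, i.e. with the
order-zero variables `X̲₀` set to `0`.  The variable `(j, i) : Fin N × Fin m` stands for
`X_{j+1, i+1}`. -/
noncomputable def jetPoly (k : Type*) [CommRing k] (N m : ℕ)
    (f : MvPolynomial (Fin N) k) (n : ℕ) : MvPolynomial (Fin N × Fin m) k :=
  (Polynomial.coeff
    (MvPolynomial.aeval
      (fun j : Fin N =>
        ∑ i : Fin m,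
          Polynomial.C (MvPolynomial.X (R := k) (j, i)) * Polynomial.X ^ ((i : ℕ) + 1)) f) n)

/-- The ideal of the `m`-th jet scheme of `V(I) ⊆ 𝔸^N` centered at the origin:
generated by the jet equations `Fₙ⁰` for `1 ≤ n ≤ m`, `f ∈ I`. -/
noncomputable def jetIdeal (k : Type*) [CommRing k] (N : ℕ)
    (I : Ideal (MvPolynomial (Fin N) k)) (m : ℕ) :
    Ideal (MvPolynomial (Fin N × Fin m) k) :=
  Ideal.span {g | ∃ f ∈ I, ∃ n, 1 ≤ n ∧ n ≤ m ∧ g = jetPoly k N m f n}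

/-- Killing the variables in `s` presents `k[σ] / (X_i : i ∈ s)` as the polynomial ring in the
remaining variables. -/
theorem ker_killCompl_compl (k : Type*) [CommRing k] {σ : Type*} (s : Set σ) :
    RingHom.ker (killCompl (R := k) (f := (Subtype.val : ↥sᶜ → σ)) Subtype.val_injective) =
      Ideal.span (X '' s) := by
  classical
  ext x
  rw [RingHom.mem_ker, mem_ideal_span_X_image]
  constructor
  · intro h d hd
    by_contra! hs
    have hsub : (d.support : Set σ) ⊆ Set.range (Subtype.val : ↥sᶜ → σ) := by
      intro i hi
      have : i ∉ s := fun his => Finsupp.mem_support_iff.mp hi (hs i his)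
      simpa using this
    have h1 := congrArg (coeff (d.comapDomain _ Subtype.val_injective.injOn)) h
    rw [coeff_killCompl, Finsupp.mapDomain_comapDomain _ Subtype.val_injective _ hsub] at h1
    exact mem_support_iff.mp hd (by simpa using h1)
  · intro h
    ext d
    rw [coeff_killCompl, coeff_zero]
    by_contra hne
    obtain ⟨i, his, hi⟩ := h _ (mem_support_iff.mpr hne)
    refine hi (Finsupp.mapDomain_of_notMem_range _ _ ?_)
    simpa using his

theorem killCompl_surjective (k : Type*) [CommRing k] {σ τ : Type*} {f : σ → τ}
    (hf : Function.Injective f) : Function.Surjective (killCompl (R := k) hf) :=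
  fun p => ⟨rename f p, killCompl_rename_app hf p⟩

theorem isPrime_span_X_image (k : Type*) [CommRing k] [IsDomain k] {σ : Type*} (s : Set σ) :
    (Ideal.span (X '' s : Set (MvPolynomial σ k))).IsPrime := by
  rw [← ker_killCompl_compl]
  exact RingHom.ker_isPrime _

theorem ringKrullDim_quotient_span_X_image (k : Type*) [Field k] {σ : Type*} [Finite σ]
    (s : Set σ) :
    ringKrullDim (MvPolynomial σ k ⧸ Ideal.span (X '' s : Set (MvPolynomial σ k))) =
      (Nat.card ↥sᶜ : ℕ) := by
  rw [← ker_killCompl_compl]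
  have h := ringKrullDim_eq_of_ringEquiv (RingHom.quotientKerEquivOfSurjective
    (f := (killCompl (R := k) (f := (Subtype.val : ↥sᶜ → σ)) Subtype.val_injective).toRingHom)
    (killCompl_surjective k _))
  rw [MvPolynomial.ringKrullDim_of_isNoetherianRing, ringKrullDim_eq_zero_of_field,
    zero_add] at h
  exact h

theorem X_mem_span_X_image_iff (k : Type*) [CommRing k] [Nontrivial k] {σ : Type*} (s : Set σ)
    (i : σ) : (X i : MvPolynomial σ k) ∈ Ideal.span (X '' s : Set (MvPolynomial σ k)) ↔ i ∈ s := by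
  classical
  rw [mem_ideal_span_X_image]
  simp [support_X, Finsupp.single_apply]

theorem span_X_image_le_span_X_image_iff (k : Type*) [CommRing k] [Nontrivial k] {σ : Type*}
    (s t : Set σ) :
    Ideal.span (X '' s : Set (MvPolynomial σ k)) ≤ Ideal.span (X '' t) ↔ s ⊆ t := by
  rw [Ideal.span_le, Set.image_subset_iff]
  exact forall₂_congr fun i _ => X_mem_span_X_image_iff k t i

/-- The minimal primes over `I` are the members of any antichain of primes over `I` below every
prime over `I`. -/
theorem minimalPrimes_eq_range {R ι : Type*} [CommRing R] {I : Ideal R} (P : ι → Ideal R)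
    (hP : ∀ i, (P i).IsPrime) (hI : ∀ i, I ≤ P i) (hanti : ∀ i j, P i ≤ P j → i = j)
    (hle : ∀ p : Ideal R, p.IsPrime → I ≤ p → ∃ i, P i ≤ p) :
    I.minimalPrimes = Set.range P := by
  ext p
  constructor
  · intro hp
    obtain ⟨i, hi⟩ := hle p hp.1.1 hp.1.2
    exact ⟨i, le_antisymm hi (hp.2 ⟨hP i, hI i⟩ hi)⟩
  · rintro ⟨i, rfl⟩
    refine ⟨⟨hP i, hI i⟩, fun q hq hqi => ?_⟩
    obtain ⟨j, hj⟩ := hle q hq.1 hq.2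
    obtain rfl := hanti j i (hj.trans hqi)
    exact hj

theorem ringKrullDim_le_of_forall_minimalPrimes {R : Type*} [CommRing R] {d : WithBot ℕ∞}
    (h : ∀ p ∈ minimalPrimes R, ringKrullDim (R ⧸ p) ≤ d) : ringKrullDim R ≤ d := by
  rw [ringKrullDim, Order.krullDim_eq_iSup_coheight, iSup_le_iff]
  intro q
  obtain ⟨p, hp, hpq⟩ := Ideal.exists_minimalPrimes_le (I := ⊥) (J := q.asIdeal) bot_le
  refine le_trans ?_ (h p hp)
  rw [Order.coheight_eq_krullDim_Ici, ringKrullDim_quotient]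
  exact Order.krullDim_le_of_strictMono
    (fun x : Set.Ici q => (⟨x.1, fun a ha => x.2 (hpq ha)⟩ : PrimeSpectrum.zeroLocus (p : Set R)))
    fun _ _ hxy => hxy

theorem ringKrullDim_quotient_quotient {R : Type*} [CommRing R] (I : Ideal R) (p : Ideal (R ⧸ I)) :
    ringKrullDim ((R ⧸ I) ⧸ p) = ringKrullDim (R ⧸ p.comap (Ideal.Quotient.mk I)) := by
  refine (ringKrullDim_eq_of_ringEquiv (Ideal.quotientEquiv _ _
    (RingEquiv.refl _) ?_)).trans (ringKrullDim_eq_of_ringEquiv (DoubleQuot.quotQuotEquivQuotOfLE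
      (I := I) (J := p.comap (Ideal.Quotient.mk I)) ?_))
  · rw [Ideal.map_comap_of_surjective _ Ideal.Quotient.mk_surjective]
    exact (Ideal.map_id p).symm
  · intro x hx
    rw [Ideal.mem_comap, Ideal.Quotient.eq_zero_iff_mem.mpr hx]
    exact zero_mem p

/-- The `j`-th coordinate `∑_{i ≥ 1} X_{j,i} tⁱ` of the universal jet centered at the origin. -/
noncomputable def jetCoord (k : Type*) [CommRing k] (N m : ℕ) (j : Fin N) :
    Polynomial (MvPolynomial (Fin N × Fin m) k) :=
  ∑ i : Fin m, Polynomial.C (MvPolynomial.X (R := k) (j, i)) * Polynomial.X ^ ((i : ℕ) + 1)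

theorem coeff_jetCoord_succ (k : Type*) [CommRing k] {N m : ℕ} (j : Fin N) (i : Fin m) :
    (jetCoord k N m j).coeff (i + 1) = X (j, i) := by
  simp [jetCoord, Polynomial.coeff_C_mul, Polynomial.coeff_X_pow,
    Fin.val_inj]

theorem coeff_jetCoord_eq_zero (k : Type*) [CommRing k] {N m : ℕ} (j : Fin N) {n : ℕ}
    (h : ∀ i : Fin m, n ≠ i + 1) : (jetCoord k N m j).coeff n = 0 := by
  simp [jetCoord, Polynomial.coeff_C_mul, Polynomial.coeff_X_pow, h]

theorem X_pow_dvd_map_jetCoord_iff (k : Type*) [CommRing k] {N m : ℕ} {K : Type*} [CommRing K]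
    (φ : MvPolynomial (Fin N × Fin m) k →+* K) (j : Fin N) (n : ℕ) :
    Polynomial.X ^ n ∣ (jetCoord k N m j).map φ ↔
      ∀ i : Fin m, (i : ℕ) + 1 < n → φ (X (j, i)) = 0 := by
  rw [Polynomial.X_pow_dvd_iff]
  constructor
  · intro h i hi
    simpa [Polynomial.coeff_map, coeff_jetCoord_succ] using h _ hi
  · intro h d hd
    by_cases hex : ∃ i : Fin m, d = i + 1
    · obtain ⟨i, rfl⟩ := hex
      rw [Polynomial.coeff_map, coeff_jetCoord_succ, h i hd]
    · push Not at hex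
      rw [Polynomial.coeff_map, coeff_jetCoord_eq_zero k j hex, map_zero]

theorem jetIdeal_span_mul_le_ker_iff (k : Type*) [CommRing k] {m : ℕ} {K : Type*} [CommRing K]
    (φ : MvPolynomial (Fin 2 × Fin m) k →+* K) :
    jetIdeal k 2 (Ideal.span {(X 0 * X 1 : MvPolynomial (Fin 2) k)}) m ≤ RingHom.ker φ ↔
      Polynomial.X ^ (m + 1) ∣ (jetCoord k 2 m 0).map φ * (jetCoord k 2 m 1).map φ := by
  have hF (f : MvPolynomial (Fin 2) k) (n : ℕ) :
      φ (jetPoly k 2 m f n) = ((aeval (jetCoord k 2 m) f).map φ).coeff n := by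
    rw [Polynomial.coeff_map]; rfl
  rw [jetIdeal, Ideal.span_le]
  constructor
  · intro h
    rw [Polynomial.X_pow_dvd_iff]
    intro d hd
    rcases Nat.eq_zero_or_pos d with rfl | hd0
    · rw [Polynomial.mul_coeff_zero, Polynomial.coeff_map,
        coeff_jetCoord_eq_zero k 0 (fun i => (Nat.succ_ne_zero _).symm), map_zero, zero_mul]
    · have h1 : φ (jetPoly k 2 m (X 0 * X 1) d) = 0 :=
        h ⟨_, Ideal.mem_span_singleton_self _, d, hd0, Nat.lt_succ_iff.mp hd, rfl⟩
      rw [hF] at h1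
      simpa using h1
  · rintro h _ ⟨f, hf, n, -, hn, rfl⟩
    obtain ⟨g, rfl⟩ := Ideal.mem_span_singleton.mp hf
    change φ _ = 0
    rw [hF]
    refine Polynomial.X_pow_dvd_iff.mp (h.trans ?_) n (Nat.lt_succ_iff.mpr hn)
    simp only [map_mul, aeval_X, Polynomial.map_mul]
    exact dvd_mul_right _ _

/-- If a power of the variable divides a product over a domain, it splits accordingly. -/
theorem exists_X_pow_dvd_of_X_pow_dvd_mul {K : Type*} [CommRing K] [IsDomain K]
    {a b : Polynomial K} {n : ℕ} (h : Polynomial.X ^ n ∣ a * b) :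
    ∃ i j, i + j = n ∧ Polynomial.X ^ i ∣ a ∧ Polynomial.X ^ j ∣ b := by
  obtain ⟨q, hq⟩ := h
  obtain ⟨i, j, c, d, hij, -, rfl, rfl⟩ :=
    mul_eq_mul_prime_pow Polynomial.prime_X (hq.trans (mul_comm _ _))
  exact ⟨i, j, hij, dvd_mul_left _ _, dvd_mul_left _ _⟩

/-- The indices of the variables vanishing on the component of the jet scheme of the node on
which the first coordinate has order `> s` and the second one has order `≥ m - s`. -/
def nodeIndices (m : ℕ) (s : Fin m) : Set (Fin 2 × Fin m) :=
  {x | (x.1 = 0 ∧ (x.2 : ℕ) < s) ∨ (x.1 = 1 ∧ (x.2 : ℕ) + s + 1 < m)}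

theorem card_compl_nodeIndices (m : ℕ) (s : Fin m) : Nat.card ↥(nodeIndices m s)ᶜ = m + 1 := by
  classical
  have hs := s.isLt
  rw [Nat.card_eq_fintype_card, Fintype.card_subtype, Finset.card_filter,
    Fintype.sum_prod_type, Fin.sum_univ_two, ← Finset.card_filter, ← Finset.card_filter]
  have h0 : (Finset.univ.filter fun i : Fin m => (0, i) ∈ (nodeIndices m s)ᶜ) =
      Finset.Ici s := by
    ext i; simp [nodeIndices]
  have h1 : (Finset.univ.filter fun i : Fin m => (1, i) ∈ (nodeIndices m s)ᶜ) =
      Finset.Ici ⟨m - 1 - s, by omega⟩ := by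
    ext i; simp [nodeIndices, Fin.le_def]
  rw [h0, h1, Fin.card_Ici, Fin.card_Ici]
  simp only
  omega

theorem eq_of_nodeIndices_subset {m : ℕ} {s t : Fin m} (h : nodeIndices m s ⊆ nodeIndices m t) :
    s = t := by
  have hs := s.isLt
  have ht := t.isLt
  rcases lt_trichotomy s t with hst | hst | hst
  · have := @h (1, ⟨m - 1 - t, by omega⟩) (by simp [nodeIndices]; omega)
    simp [nodeIndices] at this
    omega
  · exact hst
  · have := @h (0, t) (by simpa [nodeIndices] using hst)
    simp [nodeIndices] at this

theorem jetIdeal_node_le_span_nodeIndices (k : Type*) [CommRing k] {m : ℕ} (s : Fin m) :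
    jetIdeal k 2 (Ideal.span {(X 0 * X 1 : MvPolynomial (Fin 2) k)}) m ≤
      Ideal.span (X '' nodeIndices m s) := by
  have hs := s.isLt
  rw [← Ideal.mk_ker (I := Ideal.span (X '' nodeIndices m s : Set (MvPolynomial _ k))),
    jetIdeal_span_mul_le_ker_iff, show m + 1 = (s + 1) + (m - s) by omega, pow_add]
  refine mul_dvd_mul ?_ ?_ <;>
  · rw [X_pow_dvd_map_jetCoord_iff]
    intro i hi
    rw [Ideal.Quotient.eq_zero_iff_mem]
    refine Ideal.subset_span (Set.mem_image_of_mem _ ?_)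
    simp [nodeIndices]
    omega

theorem exists_span_nodeIndices_le (k : Type*) [CommRing k] {m : ℕ} (hm : 1 ≤ m)
    (p : Ideal (MvPolynomial (Fin 2 × Fin m) k)) [p.IsPrime]
    (hp : jetIdeal k 2 (Ideal.span {(X 0 * X 1 : MvPolynomial (Fin 2) k)}) m ≤ p) :
    ∃ s : Fin m, Ideal.span (X '' nodeIndices m s) ≤ p := by
  rw [← Ideal.mk_ker (I := p), jetIdeal_span_mul_le_ker_iff] at hp
  obtain ⟨a, b, hab, ha, hb⟩ := exists_X_pow_dvd_of_X_pow_dvd_mul hp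
  rw [X_pow_dvd_map_jetCoord_iff] at ha hb
  refine ⟨⟨min (a - 1) (m - 1), by omega⟩, ?_⟩
  rw [Ideal.span_le]
  rintro _ ⟨⟨j, i⟩, hx, rfl⟩
  have hi := i.isLt
  simp only [nodeIndices, Set.mem_ofPred_eq] at hx
  rw [SetLike.mem_coe, ← Ideal.Quotient.eq_zero_iff_mem]
  rcases hx with ⟨rfl, hx⟩ | ⟨rfl, hx⟩
  · exact ha i (by omega)
  · exact hb i (by omega)

theorem minimalPrimes_jetIdeal_node (k : Type*) [CommRing k] [IsDomain k] {m : ℕ} (hm : 1 ≤ m) :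
    (jetIdeal k 2 (Ideal.span {(X 0 * X 1 : MvPolynomial (Fin 2) k)}) m).minimalPrimes =
      Set.range fun s : Fin m => Ideal.span (X '' nodeIndices m s) :=
  minimalPrimes_eq_range _ (fun _ => isPrime_span_X_image k _)
    (jetIdeal_node_le_span_nodeIndices k)
    (fun _ _ h => eq_of_nodeIndices_subset ((span_X_image_le_span_X_image_iff k _ _).mp h))
    (fun p _ hp => exists_span_nodeIndices_le k hm p hp)

theorem node_jet_scheme_components (k : Type*) [Field k] [IsAlgClosed k] [CharZero k]
    (m : ℕ) (hm : 1 ≤ m) :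
    (minimalPrimes (MvPolynomial (Fin 2 × Fin m) k ⧸
        jetIdeal k 2 (Ideal.span {(X 0 * X 1 : MvPolynomial (Fin 2) k)}) m)).ncard = m ∧
    (∀ p ∈ minimalPrimes (MvPolynomial (Fin 2 × Fin m) k ⧸
        jetIdeal k 2 (Ideal.span {(X 0 * X 1 : MvPolynomial (Fin 2) k)}) m),
      ringKrullDim ((MvPolynomial (Fin 2 × Fin m) k ⧸
        jetIdeal k 2 (Ideal.span {(X 0 * X 1 : MvPolynomial (Fin 2) k)}) m) ⧸ p)
        = (m + 1 : ℕ)) ∧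
    ringKrullDim (MvPolynomial (Fin 2 × Fin m) k ⧸
        jetIdeal k 2 (Ideal.span {(X 0 * X 1 : MvPolynomial (Fin 2) k)}) m)
      = (m + 1 : ℕ) := by
  set J := jetIdeal k 2 (Ideal.span {(X 0 * X 1 : MvPolynomial (Fin 2) k)}) m with hJ
  have hmin := minimalPrimes_jetIdeal_node k hm
  rw [← hJ] at hmin
  have hdim : ∀ p ∈ minimalPrimes (MvPolynomial (Fin 2 × Fin m) k ⧸ J),
      ringKrullDim ((MvPolynomial (Fin 2 × Fin m) k ⧸ J) ⧸ p) = (m + 1 : ℕ) := by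
    intro p hp
    have hmem : p.comap (Ideal.Quotient.mk J) ∈ J.minimalPrimes := by
      rw [Ideal.minimalPrimes_eq_comap]
      exact Set.mem_image_of_mem _ hp
    rw [hmin] at hmem
    obtain ⟨s, hs⟩ := hmem
    rw [ringKrullDim_quotient_quotient, ← hs, ringKrullDim_quotient_span_X_image,
      card_compl_nodeIndices]
  have hcard : (minimalPrimes (MvPolynomial (Fin 2 × Fin m) k ⧸ J)).ncard = m := by
    rw [← Set.ncard_image_of_injective _
      (Ideal.comap_injective_of_surjective _ Ideal.Quotient.mk_surjective),
      ← Ideal.minimalPrimes_eq_comap, hmin, ← Set.image_univ, Set.ncard_image_of_injective,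
      Set.ncard_univ, Nat.card_eq_fintype_card, Fintype.card_fin]
    exact fun s t h =>
      eq_of_nodeIndices_subset ((span_X_image_le_span_X_image_iff k _ _).mp h.le)
  refine ⟨hcard, hdim, le_antisymm
    (ringKrullDim_le_of_forall_minimalPrimes fun p hp => (hdim p hp).le) ?_⟩
  obtain ⟨p, hp⟩ := Set.nonempty_of_ncard_ne_zero (hcard.trans_ne (Nat.one_le_iff_ne_zero.mp hm))
  rw [← hdim p hp]
  exact ringKrullDim_le_of_surjective _ Ideal.Quotient.mk_surjective
end

section
/- Let X ⊂ X' be varieties with dim X = d − c, X cut out in the d-dimensional variety X' by c elements of 𝒪_{X'}, and x₀ ∈ X a closed point. Then for every m ≥ 1, dim 𝒪_{X'_m⁰} ≤ dim 𝒪_{X_m⁰} + mc, i.e. dim X'_m⁰ ≤ dim X_m⁰ + mc. -/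
/-!
STATEMENT 8: Let `X' = V(I) ⊆ 𝔸^N` be a `d`-dimensional variety and `X ⊆ X'` a
`(d−c)`-dimensional subvariety cut out by `c` elements `g₁,…,g_c` of `𝒪_{X'}`, with `x₀`
(the origin) a closed point of `X`.  Then for every `m ≥ 1`,
`dim X'ₘ⁰ ≤ dim Xₘ⁰ + mc`.
-/

open MvPolynomial

namespace MvPolynomial

theorem height_eq_of_isMaximal {k : Type*} [Field k] (n : ℕ)
    (P : Ideal (MvPolynomial (Fin n) k)) [P.IsMaximal] : P.height = n := by
  induction n with
  | zero =>
    have h := Ideal.height_le_ringKrullDim_of_ne_top (I := P) Ideal.IsPrime.ne_top'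
    rw [ringKrullDim_of_isNoetherianRing, ringKrullDim_eq_zero_of_field] at h
    simp only [Nat.card_eq_fintype_card, Fintype.card_fin, Nat.cast_zero, add_zero] at h
    exact le_antisymm (by exact_mod_cast h) bot_le
  | succ n ih =>
    let e : MvPolynomial (Fin (n + 1)) k ≃+* Polynomial (MvPolynomial (Fin n) k) :=
      (finSuccEquiv k n).toRingEquiv
    let Q : Ideal (Polynomial (MvPolynomial (Fin n) k)) := P.comap e.symm
    have : Q.IsMaximal := Ideal.comap_isMaximal_of_equiv e.symm
    have : (Q.comap Polynomial.C).IsMaximal := Polynomial.isMaximal_comap_C_of_isJacobsonRing Q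
    have : Q.LiesOver (Q.comap Polynomial.C) := ⟨rfl⟩
    rw [← RingEquiv.height_comap e.symm P,
      Polynomial.height_eq_height_add_one (Q.comap Polynomial.C) Q, ih]
    simp

end MvPolynomial

theorem ringKrullDim_le_of_isIntegral (R S : Type*) [CommRing R] [CommRing S] [Algebra R S]
    [Algebra.IsIntegral R S] : ringKrullDim S ≤ ringKrullDim R :=
  Order.krullDim_le_of_strictMono (PrimeSpectrum.comap (algebraMap R S)) fun _ _ h ↦
    Ideal.IsIntegral.comap_lt_comap h

/-- Every maximal ideal of an affine domain over a field has full height. -/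
theorem Ideal.ringKrullDim_le_height_of_isMaximal (k : Type*) {A : Type*} [Field k] [CommRing A]
    [IsDomain A] [Algebra k A] [Algebra.FiniteType k A] (Q : Ideal A) [Q.IsMaximal] :
    ringKrullDim A ≤ Q.height := by
  obtain ⟨s, g, hinj, hfin⟩ := exists_finite_inj_algHom_of_fg k A
  replace hfin : g.toRingHom.Finite := hfin
  algebraize [g.toRingHom]
  have : FaithfulSMul (MvPolynomial (Fin s) k) A :=
    (faithfulSMul_iff_algebraMap_injective _ _).mpr hinj
  have : IsNoetherianRing A := Algebra.FiniteType.isNoetherianRing k A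
  let q := Q.under (MvPolynomial (Fin s) k)
  have : q.IsMaximal := Ideal.IsMaximal.of_isMaximal_liesOver Q q
  have hq : q.height ≤ Q.height := by
    rw [Ideal.height_eq_height_add_of_liesOver_of_hasGoingDown q Q]
    exact le_self_add
  rw [MvPolynomial.height_eq_of_isMaximal] at hq
  refine (ringKrullDim_le_of_isIntegral (MvPolynomial (Fin s) k) A).trans ?_
  rw [MvPolynomial.ringKrullDim_of_isNoetherianRing, ringKrullDim_eq_zero_of_field]
  simpa using WithBot.coe_le_coe.mpr hq

theorem Ideal.height_comap_le_of_surjective {R S : Type*} [CommRing R] [CommRing S] {f : R →+* S}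
    (hf : Function.Surjective f) (P : Ideal S) [P.IsPrime] : P.height ≤ (P.comap f).height := by
  have h := Order.height_le_height_apply_of_strictMono _ (RingHom.strictMono_comap_of_surjective hf)
    ⟨P, inferInstance⟩
  rwa [← PrimeSpectrum.height_eq_orderHeight, ← PrimeSpectrum.height_eq_orderHeight] at h

/-- In an affine algebra, a maximal ideal that meets every irreducible component has full height. -/
theorem Ideal.ringKrullDim_le_height_of_forall_isPrime (k : Type*) {A : Type*} [Field k]
    [CommRing A] [Algebra k A] [Algebra.FiniteType k A] (M : Ideal A) [M.IsMaximal]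
    (hM : ∀ q : Ideal A, q.IsPrime → ∃ p ≤ q, p.IsPrime ∧ p ≤ M) :
    ringKrullDim A ≤ M.height := by
  refine iSup_le fun l ↦ ?_
  obtain ⟨p, hpq, hp, hpM⟩ := hM l.head.asIdeal l.head.isPrime
  let l' : LTSeries (PrimeSpectrum.zeroLocus (p : Set A)) :=
    { length := l.length
      toFun i := ⟨l i, hpq.trans (l.head_le i)⟩
      step i := l.step i }
  have hl : (l.length : WithBot ℕ∞) ≤ ringKrullDim (A ⧸ p) := by
    rw [ringKrullDim_quotient]
    exact Order.LTSeries.length_le_krullDim l'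
  have hmap : (M.map (Ideal.Quotient.mk p)).comap (Ideal.Quotient.mk p) = M :=
    Ideal.comap_map_of_surjective' _ Ideal.Quotient.mk_surjective M |>.trans (by simpa)
  have : (M.map (Ideal.Quotient.mk p)).IsMaximal :=
    .map_of_surjective_of_ker_le (f := Ideal.Quotient.mk p) Ideal.Quotient.mk_surjective (by simpa)
  refine hl.trans ((Ideal.ringKrullDim_le_height_of_isMaximal k
    (M.map (Ideal.Quotient.mk p))).trans ?_)
  have := Ideal.height_comap_le_of_surjective Ideal.Quotient.mk_surjective
    (M.map (Ideal.Quotient.mk p))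
  rw [hmap] at this
  exact WithBot.coe_le_coe.mpr this

namespace MvPolynomial

attribute [local instance] weightedGradedAlgebra

theorem constantCoeff_eq_zero_of_isHomogeneous_of_isPrime {k σ : Type*} [Field k] {w : σ → ℕ}
    (hw : ∀ i, w i ≠ 0) {P : Ideal (MvPolynomial σ k)}
    (hP : P.IsHomogeneous (weightedHomogeneousSubmodule k w)) (hP1 : P.IsPrime)
    {f : MvPolynomial σ k} (hf : f ∈ P) : constantCoeff f = 0 := by
  by_contra h
  have h0 := weightedHomogeneousComponent_mem_of_mem k w hP hf 0
  rw [weightedHomogeneousComponent_zero f hw] at h0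
  exact hP1.ne_top (P.eq_top_of_isUnit_mem h0 ((IsUnit.mk0 _ h).map C))

/-- Krull's height theorem for a positively graded affine algebra. -/
theorem ringKrullDim_quotient_le_add_encard {k σ : Type*} [Field k] [Finite σ] {w : σ → ℕ}
    (hw : ∀ i, w i ≠ 0) {J J' : Ideal (MvPolynomial σ k)}
    (hJ : J.IsHomogeneous (weightedHomogeneousSubmodule k w))
    (hJ0 : J ≤ RingHom.ker (constantCoeff (R := k) (σ := σ))) {s : Set (MvPolynomial σ k)}
    (hs : ∀ f ∈ s, constantCoeff f = 0) (hJ' : J' ≤ J ⊔ Ideal.span s) :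
    ringKrullDim (MvPolynomial σ k ⧸ J) ≤ ringKrullDim (MvPolynomial σ k ⧸ J') + s.encard := by
  let mk := Ideal.Quotient.mk J
  let φ : MvPolynomial σ k ⧸ J →+* k := Ideal.Quotient.lift J constantCoeff hJ0
  have hφ : Function.Surjective φ := fun a ↦ ⟨mk (C a), constantCoeff_C σ a⟩
  have : (RingHom.ker φ).IsMaximal := RingHom.ker_isMaximal_of_surjective φ hφ
  have hdim : ringKrullDim (MvPolynomial σ k ⧸ J) ≤ (RingHom.ker φ).height := by
    refine Ideal.ringKrullDim_le_height_of_forall_isPrime k _ fun q hq ↦ ?_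
    let P := ((q.comap mk).homogeneousCore (weightedHomogeneousSubmodule k w)).toIdeal
    have hP : P.IsPrime := (hq.comap mk).homogeneousCore
    have hJP : J ≤ P := by
      have h := Ideal.homogeneousCore_mono (weightedHomogeneousSubmodule k w)
        (show J ≤ q.comap mk from fun x hx ↦ by
          simp [mk, Ideal.Quotient.eq_zero_iff_mem.mpr hx])
      rwa [← hJ.toIdeal_homogeneousCore_eq_self]
    refine ⟨P.map mk, ?_, ?_, ?_⟩
    · exact Ideal.map_le_iff_le_comap.mpr (Ideal.toIdeal_homogeneousCore_le _ _)
    · exact Ideal.map_isPrime_of_surjective Ideal.Quotient.mk_surjective (by simpa [mk])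
    · refine Ideal.map_le_iff_le_comap.mpr fun f hf ↦ ?_
      exact constantCoeff_eq_zero_of_isHomogeneous_of_isPrime hw
        (HomogeneousIdeal.isHomogeneous _) hP hf
  have hs' : mk '' s ⊆ RingHom.ker φ := by
    rintro _ ⟨f, hf, rfl⟩
    exact hs f hf
  let ψ : MvPolynomial σ k ⧸ J' →+* (MvPolynomial σ k ⧸ J) ⧸ Ideal.span (mk '' s) :=
    Ideal.Quotient.lift J' ((Ideal.Quotient.mk _).comp mk) <| by
      change J' ≤ RingHom.ker _
      refine hJ'.trans (sup_le (fun f hf ↦ ?_) (Ideal.span_le.mpr fun f hf ↦ ?_))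
      · simp [mk, Ideal.Quotient.eq_zero_iff_mem.mpr hf]
      · exact Ideal.Quotient.eq_zero_iff_mem.mpr (Ideal.subset_span ⟨f, hf, rfl⟩)
  have hψ : Function.Surjective ψ := Ideal.Quotient.lift_surjective_of_surjective _ _
    (Ideal.Quotient.mk_surjective.comp Ideal.Quotient.mk_surjective)
  refine hdim.trans ((Ideal.height_le_ringKrullDim_quotient_add_encard _ hs').trans ?_)
  exact add_le_add (ringKrullDim_le_of_surjective ψ hψ)
    (WithBot.coe_le_coe.mpr (Set.encard_image_le mk s))

end MvPolynomial

section Jet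

variable {k : Type*} [CommRing k] {N m : ℕ}

theorem jetPoly_add (f g : MvPolynomial (Fin N) k) (n : ℕ) :
    jetPoly k N m (f + g) n = jetPoly k N m f n + jetPoly k N m g n := by
  simp [jetPoly]

theorem jetPoly_mul (f g : MvPolynomial (Fin N) k) (n : ℕ) :
    jetPoly k N m (f * g) n =
      ∑ p ∈ Finset.HasAntidiagonal.antidiagonal n, jetPoly k N m f p.1 * jetPoly k N m g p.2 := by
  simp [jetPoly, Polynomial.coeff_mul]

theorem jetPoly_zero_right (f : MvPolynomial (Fin N) k) :
    jetPoly k N m f 0 = C (aeval (fun _ : Fin N => (0 : k)) f) := by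
  induction f using MvPolynomial.induction_on with
  | C a => simp [jetPoly, ← MvPolynomial.algebraMap_eq, Polynomial.algebraMap_apply]
  | add f g hf hg => rw [jetPoly_add, hf, hg, map_add, map_add]
  | mul_X f i hf => simp [jetPoly, Polynomial.finsetSum_coeff]

theorem isWeightedHomogeneous_jetPoly (f : MvPolynomial (Fin N) k) (n : ℕ) :
    IsWeightedHomogeneous (fun p : Fin N × Fin m ↦ (p.2 : ℕ) + 1) (jetPoly k N m f n) n := by
  induction f using MvPolynomial.induction_on generalizing n with
  | C a =>
    rw [jetPoly, ← MvPolynomial.algebraMap_eq, AlgHom.commutes, Polynomial.algebraMap_apply,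
      Polynomial.coeff_C]
    split_ifs with h
    · subst h
      exact isWeightedHomogeneous_C _ _
    · exact isWeightedHomogeneous_zero _ _ _
  | add f g hf hg =>
    rw [jetPoly_add]
    exact (hf n).add (hg n)
  | mul_X f j hf =>
    rw [jetPoly_mul]
    refine IsWeightedHomogeneous.sum _ _ _ fun p hp ↦ ?_
    rw [← Finset.HasAntidiagonal.mem_antidiagonal.mp hp]
    refine (hf p.1).mul ?_
    simp only [jetPoly, aeval_X, Polynomial.finsetSum_coeff, Polynomial.coeff_C_mul_X_pow]
    refine IsWeightedHomogeneous.sum _ _ _ fun i _ ↦ ?_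
    split_ifs with h
    · rw [h]
      exact isWeightedHomogeneous_X k _ (j, i)
    · exact isWeightedHomogeneous_zero _ _ _

theorem constantCoeff_jetPoly (f : MvPolynomial (Fin N) k) {n : ℕ} (hn : n ≠ 0) :
    constantCoeff (jetPoly k N m f n) = 0 :=
  (isWeightedHomogeneous_jetPoly f n).coeff_eq_zero 0 (by simpa using hn.symm)

theorem jetPoly_mem_of_mem_span {ι : Type*} {g : ι → MvPolynomial (Fin N) k}
    (hg : ∀ i, aeval (fun _ : Fin N => (0 : k)) (g i) = 0) {f : MvPolynomial (Fin N) k}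
    (hf : f ∈ Ideal.span (Set.range g)) {n : ℕ} (hn : n ≤ m) :
    jetPoly k N m f n ∈
      Ideal.span (Set.range fun p : ι × Fin m ↦ jetPoly k N m (g p.1) (p.2 + 1)) := by
  induction hf using Submodule.span_induction generalizing n with
  | mem _ h =>
    obtain ⟨i, rfl⟩ := h
    cases n with
    | zero => simp [jetPoly_zero_right, hg]
    | succ n => exact Ideal.subset_span ⟨(i, ⟨n, hn⟩), rfl⟩
  | zero => simp [jetPoly]
  | add x y _ _ hx hy =>
    rw [jetPoly_add]
    exact add_mem (hx hn) (hy hn)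
  | smul a x _ hx =>
    rw [smul_eq_mul, jetPoly_mul]
    exact sum_mem fun p hp ↦
      Ideal.mul_mem_left _ _ (hx
        (by have := Finset.HasAntidiagonal.mem_antidiagonal.mp hp; lia))

theorem jetIdeal_sup_span_le {ι : Type*} (I : Ideal (MvPolynomial (Fin N) k))
    {g : ι → MvPolynomial (Fin N) k}
    (hg : ∀ i, aeval (fun _ : Fin N => (0 : k)) (g i) = 0) :
    jetIdeal k N (I ⊔ Ideal.span (Set.range g)) m ≤ jetIdeal k N I m ⊔
      Ideal.span (Set.range fun p : ι × Fin m ↦ jetPoly k N m (g p.1) (p.2 + 1)) := by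
  refine Ideal.span_le.mpr ?_
  rintro _ ⟨f, hf, n, hn, hnm, rfl⟩
  obtain ⟨a, ha, b, hb, rfl⟩ := Submodule.mem_sup.mp hf
  rw [jetPoly_add]
  exact Submodule.add_mem_sup (Ideal.subset_span ⟨a, ha, n, hn, hnm, rfl⟩)
    (jetPoly_mem_of_mem_span hg hb hnm)

attribute [local instance] weightedGradedAlgebra in
theorem isHomogeneous_jetIdeal (I : Ideal (MvPolynomial (Fin N) k)) :
    (jetIdeal k N I m).IsHomogeneous
      (weightedHomogeneousSubmodule k fun p : Fin N × Fin m ↦ (p.2 : ℕ) + 1) := by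
  refine Ideal.homogeneous_span _ _ ?_
  rintro _ ⟨f, _, n, _, _, rfl⟩
  exact ⟨n, isWeightedHomogeneous_jetPoly f n⟩

theorem jetIdeal_le_ker_constantCoeff (I : Ideal (MvPolynomial (Fin N) k)) :
    jetIdeal k N I m ≤ RingHom.ker (constantCoeff (R := k) (σ := Fin N × Fin m)) := by
  refine Ideal.span_le.mpr ?_
  rintro _ ⟨f, _, n, hn, _, rfl⟩
  exact constantCoeff_jetPoly f (by lia)

end Jet

theorem jet_dim_le_of_cut (k : Type*) [Field k] [IsAlgClosed k] [CharZero k]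
    (N d c : ℕ) (hc : c ≤ d)
    (I : Ideal (MvPolynomial (Fin N) k)) (hrad : I.IsRadical)
    (hdim : ringKrullDim (MvPolynomial (Fin N) k ⧸ I) = (d : ℕ))
    (g : Fin c → MvPolynomial (Fin N) k)
    (hdim' : ringKrullDim (MvPolynomial (Fin N) k ⧸ (I ⊔ Ideal.span (Set.range g)))
      = (d - c : ℕ))
    (horigin : ∀ f ∈ I ⊔ Ideal.span (Set.range g),
      MvPolynomial.aeval (fun _ : Fin N => (0 : k)) f = 0) :
    ∀ m : ℕ, 1 ≤ m →
      ringKrullDim (MvPolynomial (Fin N × Fin m) k ⧸ jetIdeal k N I m) ≤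
        ringKrullDim (MvPolynomial (Fin N × Fin m) k ⧸
          jetIdeal k N (I ⊔ Ideal.span (Set.range g)) m) + (m * c : ℕ) := by
  intro m _
  have hg : ∀ i, aeval (fun _ : Fin N => (0 : k)) (g i) = 0 := fun i ↦
    horigin _ (Ideal.mem_sup_right (Ideal.subset_span ⟨i, rfl⟩))
  refine (ringKrullDim_quotient_le_add_encard (fun _ ↦ Nat.succ_ne_zero _)
    (isHomogeneous_jetIdeal I) (jetIdeal_le_ker_constantCoeff I) ?_
    (jetIdeal_sup_span_le I hg)).trans (add_le_add_right ?_ _)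
  · rintro _ ⟨p, rfl⟩
    exact constantCoeff_jetPoly _ (Nat.succ_ne_zero _)
  · rw [← Set.image_univ]
    refine (WithBot.coe_le_coe.mpr (Set.encard_image_le _ _)).trans (le_of_eq ?_)
    simp [Set.encard_univ, mul_comm]
end

section
/- Let (X, x₀) be a hypersurface germ of multiplicity 2 in 𝔸^{d+1} with τ(X,x₀) ≥ 3 (so its equation can be written x₁² + x₂² + x₃² + (terms in other variables or higher order) = 0 in the completed local ring). Then (X, x₀) is a compound Du Val singularity. -/
/-!
STATEMENT 12: Let `(X, x₀)` be a hypersurface germ of multiplicity 2 in `𝔸^{d+1}` with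
`τ(X,x₀) ≥ 3`, so that its equation in the completed local ring can be written as
`x₁² + x₂² + x₃² + h = 0` where `h` consists of terms involving the other variables or of
order `≥ 3`.  Then `(X, x₀)` is a compound Du Val singularity, i.e. (by the paper's
Corollary 3.4) there exist `g₁,…,g_{d−2}` in the (complete) local ring whose quotient is a
Du Val surface singularity.
-/

open MvPowerSeries

noncomputable def psMaxIdeal (k : Type*) [CommRing k] (n : ℕ) :
    Ideal (MvPowerSeries (Fin n) k) :=
  Ideal.span (Set.range (MvPowerSeries.X : Fin n → MvPowerSeries (Fin n) k))

/-- `f` is one of the ADE (Du Val / rational double point) normal forms. -/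
def IsDuValEquation (k : Type*) [CommRing k] (f : MvPowerSeries (Fin 3) k) : Prop :=
  (∃ n : ℕ, 1 ≤ n ∧ f = X 0 ^ 2 + X 1 ^ 2 + X 2 ^ (n + 1)) ∨
  (∃ n : ℕ, 4 ≤ n ∧ f = X 0 ^ 2 + X 1 ^ 2 * X 2 + X 2 ^ (n - 1)) ∨
  f = X 0 ^ 2 + X 1 ^ 3 + X 2 ^ 4 ∨
  f = X 0 ^ 2 + X 1 ^ 3 + X 1 * X 2 ^ 3 ∨
  f = X 0 ^ 2 + X 1 ^ 3 + X 2 ^ 5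

/-- A ring is a Du Val surface singularity if it is isomorphic to `k[[x₁,x₂,x₃]]/(f)` for
an ADE normal form `f`. -/
def IsDuValSing (k : Type*) [CommRing k] (S : Type*) [CommRing S] : Prop :=
  ∃ f : MvPowerSeries (Fin 3) k, IsDuValEquation k f ∧
    Nonempty (S ≃+* (MvPowerSeries (Fin 3) k ⧸ Ideal.span {f}))

namespace MvPowerSeries

/-- The ideal of power series of order at least `n`. -/
def orderIdeal (σ k : Type*) [CommRing k] (n : ℕ) : Ideal (MvPowerSeries σ k) where
  carrier := {f | (n : ℕ∞) ≤ f.order}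
  add_mem' hf hg := (le_min hf hg).trans min_order_le_add
  zero_mem' := by simp
  smul_mem' a f hf := (le_trans hf le_add_self).trans le_order_mul

variable {σ k : Type*} [CommRing k]

lemma mem_orderIdeal {n : ℕ} {f : MvPowerSeries σ k} :
    f ∈ orderIdeal σ k n ↔ ∀ d : σ →₀ ℕ, d.degree < n → coeff d f = 0 :=
  ⟨fun hf _ hd ↦ coeff_of_lt_order ((Nat.cast_lt.2 hd).trans_le hf), nat_le_order⟩

lemma orderIdeal_anti {m n : ℕ} (h : m ≤ n) : orderIdeal σ k n ≤ orderIdeal σ k m :=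
  fun _ hf ↦ mem_orderIdeal.2 fun d hd ↦ mem_orderIdeal.1 hf d (hd.trans_le h)

lemma mul_mem_orderIdeal {m n : ℕ} {f g : MvPowerSeries σ k} (hf : f ∈ orderIdeal σ k m)
    (hg : g ∈ orderIdeal σ k n) : f * g ∈ orderIdeal σ k (m + n) := by
  have := (add_le_add hf hg).trans le_order_mul
  exact_mod_cast this

lemma mem_orderIdeal_one {f : MvPowerSeries σ k} :
    f ∈ orderIdeal σ k 1 ↔ constantCoeff f = 0 := by
  rw [← one_le_order_iff_constCoeff_eq_zero]
  exact Iff.of_eq (by norm_cast)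

lemma X_mem_orderIdeal (i : σ) : (X i : MvPowerSeries σ k) ∈ orderIdeal σ k 1 := by
  simp [mem_orderIdeal_one]

lemma orderIdeal_zero : orderIdeal σ k 0 = ⊤ :=
  eq_top_iff.2 fun _ _ ↦ mem_orderIdeal.2 (by simp)

lemma eq_zero_of_forall_mem_orderIdeal {f : MvPowerSeries σ k}
    (h : ∀ n, f ∈ orderIdeal σ k n) : f = 0 := by
  ext d
  exact mem_orderIdeal.1 (h (d.degree + 1)) d (Nat.lt_succ_self _)

/-- Power series are complete for the order filtration. -/
lemma exists_limit_orderIdeal (a : ℕ → MvPowerSeries σ k)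
    (ha : ∀ n, a (n + 1) - a n ∈ orderIdeal σ k n) :
    ∃ b, ∀ n, b - a n ∈ orderIdeal σ k n := by
  have key : ∀ n m, n ≤ m → a m - a n ∈ orderIdeal σ k n := by
    intro n m h
    induction m, h using Nat.le_induction with
    | base => simp
    | succ m hm ih =>
      rw [← sub_add_sub_cancel]
      exact add_mem (orderIdeal_anti hm (ha m)) ih
  let b : MvPowerSeries σ k := fun d ↦ coeff d (a (d.degree + 1))
  have hb : ∀ d, coeff d b = coeff d (a (d.degree + 1)) := fun _ ↦ rfl
  refine ⟨b, fun n ↦ mem_orderIdeal.2 fun d hd ↦ ?_⟩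
  have := mem_orderIdeal.1 (key (d.degree + 1) n hd) d (Nat.lt_succ_self _)
  rw [map_sub] at this ⊢
  rw [hb, ← neg_sub, this, neg_zero]

/-- A power series each of whose monomials involves a variable from the finite set `s` is a
combination of these variables, with coefficients read off from those of the series. -/
lemma exists_eq_sum_X_mul (s : Finset σ) (f : MvPowerSeries σ k)
    (hf : ∀ d : σ →₀ ℕ, (∀ i ∈ s, d i = 0) → coeff d f = 0) :
    ∃ v : σ → MvPowerSeries σ k, f = ∑ i ∈ s, X i * v i ∧
      ∀ i d, coeff d (v i) = 0 ∨ coeff d (v i) = coeff (d + Finsupp.single i 1) f := by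
  classical
  have hc : ∀ d : σ →₀ ℕ, ∃ o : Option σ,
      (∀ i, o = some i → i ∈ s ∧ d i ≠ 0) ∧ (o = none → coeff d f = 0) := by
    intro d
    by_cases h : ∀ i ∈ s, d i = 0
    · exact ⟨none, by simp, fun _ ↦ hf d h⟩
    · push Not at h
      obtain ⟨i, hi, hd⟩ := h
      exact ⟨some i, by simp_all, by simp⟩
  choose o ho hn using hc
  let v : σ → MvPowerSeries σ k := fun i d ↦
    if o (d + Finsupp.single i 1) = some i then coeff (d + Finsupp.single i 1) f else 0
  have hv : ∀ i d, coeff d (v i) =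
    if o (d + Finsupp.single i 1) = some i then coeff (d + Finsupp.single i 1) f else 0 :=
    fun _ _ ↦ rfl
  have hterm : ∀ i d, coeff d (X i * v i) = if o d = some i then coeff d f else 0 := by
    intro i d
    rw [X, coeff_monomial_mul, one_mul]
    by_cases hd : Finsupp.single i 1 ≤ d
    · rw [if_pos hd, hv, tsub_add_cancel_of_le hd]
    · rw [if_neg hd, if_neg]
      intro h
      exact hd (Finsupp.single_le_iff.2 (Nat.one_le_iff_ne_zero.2 (ho d i h).2))
  refine ⟨v, ?_, fun i d ↦ ?_⟩
  · ext d
    rw [map_sum, Finset.sum_congr rfl fun i _ ↦ hterm i d]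
    cases h : o d with
    | none => simpa using hn d h
    | some j => simp [(ho d j h).1]
  · rw [hv]
    split_ifs <;> simp

lemma exists_eq_sum_X_mul_of_mem_orderIdeal [Fintype σ] {n : ℕ} {f : MvPowerSeries σ k}
    (hf : f ∈ orderIdeal σ k (n + 1)) :
    ∃ v : σ → MvPowerSeries σ k, f = ∑ i, X i * v i ∧ ∀ i, v i ∈ orderIdeal σ k n := by
  rw [mem_orderIdeal] at hf
  obtain ⟨v, hv, hvc⟩ := exists_eq_sum_X_mul Finset.univ f fun d hd ↦ hf d <| by
    rw [Finsupp.ext (g := 0) fun i ↦ hd i (Finset.mem_univ i)]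
    simp
  refine ⟨v, hv, fun i ↦ mem_orderIdeal.2 fun d hd ↦ ?_⟩
  rcases hvc i d with h | h
  · exact h
  · rw [h]
    exact hf _ (by simpa using hd)

section Automorphism

variable [Fintype σ] {ψ : MvPowerSeries σ k →ₐ[k] MvPowerSeries σ k}

lemma sub_mem_orderIdeal_succ (hψ : ∀ i, ψ (X i) - X i ∈ orderIdeal σ k 2) (n : ℕ)
    {f : MvPowerSeries σ k} (hf : f ∈ orderIdeal σ k n) :
    ψ f - f ∈ orderIdeal σ k (n + 1) := by
  have hX : ∀ i, ψ (X i) ∈ orderIdeal σ k 1 := fun i ↦ by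
    simpa using add_mem (orderIdeal_anti one_le_two (hψ i)) (X_mem_orderIdeal i)
  induction n generalizing f with
  | zero =>
    have hg : f - C (constantCoeff f) ∈ orderIdeal σ k (0 + 1) := by
      simp [mem_orderIdeal_one]
    have hψC : ψ (C (constantCoeff f)) = C (constantCoeff f) := ψ.commutes _
    obtain ⟨v, hv, -⟩ := exists_eq_sum_X_mul_of_mem_orderIdeal hg
    have hψg : ψ (f - C (constantCoeff f)) ∈ orderIdeal σ k (0 + 1) := by
      rw [hv, map_sum]
      refine sum_mem fun i _ ↦ ?_
      rw [map_mul]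
      exact Ideal.mul_mem_right _ _ (hX i)
    have := sub_mem hψg hg
    rwa [map_sub, hψC, sub_sub_sub_cancel_right] at this
  | succ n ih =>
    obtain ⟨v, rfl, hvn⟩ := exists_eq_sum_X_mul_of_mem_orderIdeal hf
    rw [map_sum, ← Finset.sum_sub_distrib]
    refine sum_mem fun i _ ↦ ?_
    have hv : ψ (v i) ∈ orderIdeal σ k n := by
      simpa using add_mem (orderIdeal_anti n.le_succ (ih (hvn i))) (hvn i)
    have : ψ (X i * v i) - X i * v i =
        (ψ (X i) - X i) * ψ (v i) + X i * (ψ (v i) - v i) := by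
      rw [map_mul]; ring
    rw [this]
    refine add_mem ?_ ?_
    · have := mul_mem_orderIdeal (hψ i) hv
      rwa [show 2 + n = n + 1 + 1 by omega] at this
    · have := mul_mem_orderIdeal (X_mem_orderIdeal i) (ih (hvn i))
      rwa [show 1 + (n + 1) = n + 1 + 1 by omega] at this

/-- An endomorphism of the power series ring tangent to the identity is bijective. -/
lemma bijective_of_X_sub_mem_orderIdeal (hψ : ∀ i, ψ (X i) - X i ∈ orderIdeal σ k 2) :
    Function.Bijective ψ := by
  have hsub := @sub_mem_orderIdeal_succ σ k _ _ ψ hψ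
  constructor
  · rw [injective_iff_map_eq_zero]
    intro f hf
    refine eq_zero_of_forall_mem_orderIdeal fun n ↦ ?_
    induction n with
    | zero => simp [orderIdeal_zero]
    | succ n ih => simpa [hf] using hsub n ih
  · intro f
    let r : ℕ → MvPowerSeries σ k := fun n ↦ (fun g ↦ g - ψ g)^[n] f
    have hr : ∀ n, r (n + 1) = r n - ψ (r n) := fun n ↦
      Function.iterate_succ_apply' (fun g ↦ g - ψ g) n f
    have hrn : ∀ n, r n ∈ orderIdeal σ k n := by
      intro n
      induction n with
      | zero => simp [orderIdeal_zero]
      | succ n ih =>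
        rw [hr, ← neg_sub]
        exact neg_mem (hsub n ih)
    have hsum : ∀ n, f - ψ (∑ j ∈ Finset.range n, r j) = r n := by
      intro n
      induction n with
      | zero => simp [r]
      | succ n ih => rw [Finset.sum_range_succ, map_add, ← sub_sub, ih, hr]
    obtain ⟨g, hg⟩ := exists_limit_orderIdeal (fun n ↦ ∑ j ∈ Finset.range n, r j)
      fun n ↦ by simpa [Finset.sum_range_succ] using hrn n
    refine ⟨g, (sub_eq_zero.1 (eq_zero_of_forall_mem_orderIdeal fun n ↦ ?_)).symm⟩
    have h1 : ψ (g - ∑ j ∈ Finset.range n, r j) ∈ orderIdeal σ k n := by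
      simpa using add_mem (orderIdeal_anti n.le_succ (hsub n (hg n))) (hg n)
    have h2 := sub_mem (hrn n) h1
    rwa [← hsum n, map_sub, sub_sub_sub_cancel_right] at h2

end Automorphism

/-- One step of the approximation of a series `∑ Xᵢ² + (order ≥ 3)` by a sum of squares. -/
lemma exists_better_sum_sq [Fintype σ] [Invertible (2 : k)] {G : MvPowerSeries σ k} {n : ℕ}
    {y : σ → MvPowerSeries σ k} (hy : ∀ i, y i - X i ∈ orderIdeal σ k 2)
    (hG : ∑ i, y i ^ 2 - G ∈ orderIdeal σ k (n + 3)) :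
    ∃ y' : σ → MvPowerSeries σ k, ((∀ i, y' i - X i ∈ orderIdeal σ k 2) ∧
      ∑ i, y' i ^ 2 - G ∈ orderIdeal σ k (n + 1 + 3)) ∧
      ∀ i, y' i - y i ∈ orderIdeal σ k n := by
  obtain ⟨v, hv, hvn⟩ := exists_eq_sum_X_mul_of_mem_orderIdeal hG
  let c : MvPowerSeries σ k := C (⅟2)
  have hc : 2 * c = 1 := by
    rw [show (2 : MvPowerSeries σ k) = C 2 from (map_ofNat C 2).symm, ← map_mul]
    simp
  refine ⟨fun i ↦ y i - c * v i, ⟨fun i ↦ ?_, ?_⟩, fun i ↦ ?_⟩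
  · rw [sub_right_comm]
    exact sub_mem (hy i) (Ideal.mul_mem_left _ _ (orderIdeal_anti (by omega) (hvn i)))
  · have : ∑ i, (y i - c * v i) ^ 2 - G =
        ∑ i, (c ^ 2 * (v i * v i) - (y i - X i) * v i) := by
      rw [eq_comm, ← sub_eq_zero, ← sub_eq_zero.2 hv]
      have e : ∀ i, (y i - c * v i) ^ 2 =
          y i ^ 2 - X i * v i + (c ^ 2 * (v i * v i) - (y i - X i) * v i) := fun i ↦ by
        linear_combination (- y i * v i) * hc
      simp only [e, Finset.sum_add_distrib, Finset.sum_sub_distrib]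
      linear_combination (-2 : MvPowerSeries σ k) * hv
    rw [this]
    refine sum_mem fun i _ ↦ sub_mem (Ideal.mul_mem_left _ _ ?_) ?_
    · exact orderIdeal_anti (by omega) (mul_mem_orderIdeal (hvn i) (hvn i))
    · exact orderIdeal_anti (by omega) (mul_mem_orderIdeal (hy i) (hvn i))
  · rw [sub_sub_cancel_left]
    exact neg_mem (Ideal.mul_mem_left _ _ (orderIdeal_anti (by omega) (hvn i)))

/-- A series `∑ Xᵢ² + (order ≥ 3)` is a sum of squares of series tangent to the variables. -/
lemma exists_sum_sq_eq [Fintype σ] [Invertible (2 : k)] {c : MvPowerSeries σ k}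
    (hc : c ∈ orderIdeal σ k 3) :
    ∃ y : σ → MvPowerSeries σ k, (∀ i, y i - X i ∈ orderIdeal σ k 2) ∧
      ∑ i, y i ^ 2 = ∑ i, X i ^ 2 + c := by
  set G := ∑ i, X i ^ 2 + c with hG
  let P : ℕ → (σ → MvPowerSeries σ k) → Prop := fun n y ↦
    (∀ i, y i - X i ∈ orderIdeal σ k 2) ∧ ∑ i, y i ^ 2 - G ∈ orderIdeal σ k (n + 3)
  have h0 : P 0 X := ⟨by simp, by simpa [hG] using hc⟩
  choose! next hP hnext using fun n y (h : P n y) ↦ exists_better_sum_sq h.1 h.2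
  let Y : ℕ → σ → MvPowerSeries σ k := fun n ↦ Nat.rec X next n
  have hY : ∀ n, P n (Y n) := fun n ↦ by
    induction n with
    | zero => exact h0
    | succ n ih => exact hP n _ ih
  choose y hy using fun i ↦ exists_limit_orderIdeal (fun n ↦ Y n i) fun n ↦ hnext n _ (hY n) i
  refine ⟨y, fun i ↦ ?_, sub_eq_zero.1 (eq_zero_of_forall_mem_orderIdeal fun n ↦ ?_)⟩
  · rw [← sub_add_sub_cancel _ (Y 2 i)]
    exact add_mem (hy i 2) ((hY 2).1 i)
  · rw [← sub_add_sub_cancel _ (∑ i, Y n i ^ 2), ← Finset.sum_sub_distrib]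
    refine add_mem (sum_mem fun i _ ↦ ?_) (orderIdeal_anti (by omega) (hY n).2)
    rw [sq_sub_sq]
    exact Ideal.mul_mem_left _ _ (hy i n)

/-- The formal Morse lemma: `∑ Xᵢ² + (order ≥ 3)` is a sum of squares in suitable coordinates. -/
lemma exists_algEquiv_sum_sq [Fintype σ] [Invertible (2 : k)] {c : MvPowerSeries σ k}
    (hc : c ∈ orderIdeal σ k 3) :
    ∃ ψ : MvPowerSeries σ k ≃ₐ[k] MvPowerSeries σ k,
      ψ (∑ i, X i ^ 2) = ∑ i, X i ^ 2 + c := by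
  obtain ⟨y, hy, hyG⟩ := exists_sum_sq_eq hc
  have hs : HasSubst y := hasSubst_of_constantCoeff_zero fun i ↦ mem_orderIdeal_one.1 <| by
    simpa using add_mem (orderIdeal_anti one_le_two (hy i)) (X_mem_orderIdeal i)
  have hX : ∀ i, substAlgHom (R := k) hs (X i) = y i := substAlgHom_X hs
  refine ⟨AlgEquiv.ofBijective (substAlgHom hs)
    (bijective_of_X_sub_mem_orderIdeal fun i ↦ by rw [hX]; exact hy i), ?_⟩
  simp only [AlgEquiv.coe_ofBijective, map_sum, map_pow, hX, hyG]

lemma ker_killCompl {τ : Type*} [Fintype τ] (e : σ ↪ τ) :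
    RingHom.ker (killCompl (R := k) e) = Ideal.span (X '' (Set.range e)ᶜ) := by
  classical
  refine le_antisymm (fun f hf ↦ ?_) (Ideal.span_le.2 ?_)
  · obtain ⟨v, rfl, -⟩ := exists_eq_sum_X_mul {i | i ∉ Set.range e} f fun d hd ↦ by
      have hr : d ∈ Set.range (Finsupp.embDomain e) := by
        rw [Finsupp.mem_range_embDomain_iff]
        intro i hi
        by_contra h
        exact Finsupp.mem_support_iff.1 hi (hd i (by simpa using h))
      obtain ⟨x, rfl⟩ := hr
      rw [← coeff_killCompl, (RingHom.mem_ker).1 hf, map_zero]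
    refine sum_mem fun i hi ↦ Ideal.mul_mem_right _ _ (Ideal.subset_span ⟨i, ?_, rfl⟩)
    simpa using hi
  · rintro _ ⟨i, hi, rfl⟩
    exact killCompl_X_eq_zero hi

lemma killCompl_mem_orderIdeal {τ : Type*} (e : σ ↪ τ) {n : ℕ} {f : MvPowerSeries τ k}
    (hf : f ∈ orderIdeal τ k n) : killCompl e f ∈ orderIdeal σ k n := by
  rw [mem_orderIdeal] at hf ⊢
  intro d hd
  rw [coeff_killCompl]
  exact hf _ (by simpa [Finsupp.embDomain_eq_mapDomain] using hd)

end MvPowerSeries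

lemma psMaxIdeal_pow_le_orderIdeal (k : Type*) [CommRing k] (n m : ℕ) :
    psMaxIdeal k n ^ m ≤ orderIdeal (Fin n) k m := by
  have h1 : psMaxIdeal k n ≤ orderIdeal (Fin n) k 1 :=
    Ideal.span_le.2 (Set.range_subset_iff.2 X_mem_orderIdeal)
  induction m with
  | zero => simp [orderIdeal_zero]
  | succ m ih =>
    rw [pow_succ]
    exact Ideal.mul_le.2 fun f hf g hg ↦ mul_mem_orderIdeal (ih hf) (h1 hg)

theorem tau_ge_three_is_cDV (k : Type*) [Field k] [IsAlgClosed k] [CharZero k]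
    (d : ℕ) (hd : 2 ≤ d)
    (h : MvPowerSeries (Fin (d + 1)) k)
    -- `h` consists of terms involving the variables `x₄, x₅, …` or of order `≥ 3`:
    (hh : h ∈ Ideal.span {P : MvPowerSeries (Fin (d + 1)) k |
        ∃ i : Fin (d + 1), 3 ≤ (i : ℕ) ∧ P = X i} ⊔ psMaxIdeal k (d + 1) ^ 3) :
    -- `(X, x₀)` is a compound Du Val singularity:
    ∃ g : Fin (d - 2) →
        (MvPowerSeries (Fin (d + 1)) k ⧸
          Ideal.span {(X (0 : Fin (d + 1)) ^ 2 + X (1 : Fin (d + 1)) ^ 2 +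
            X (2 : Fin (d + 1)) ^ 2 + h : MvPowerSeries (Fin (d + 1)) k)}),
      IsDuValSing k
        ((MvPowerSeries (Fin (d + 1)) k ⧸
          Ideal.span {(X (0 : Fin (d + 1)) ^ 2 + X (1 : Fin (d + 1)) ^ 2 +
            X (2 : Fin (d + 1)) ^ 2 + h : MvPowerSeries (Fin (d + 1)) k)}) ⧸
          Ideal.span (Set.range g)) := by
  classical
  obtain ⟨m, rfl⟩ : ∃ m, d = m + 2 := ⟨d - 2, by omega⟩
  let e : Fin 3 ↪ Fin (m + 2 + 1) := Fin.castLEEmb (by omega)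
  have hrange : ∀ i : Fin (m + 2 + 1), i ∈ (Set.range e)ᶜ ↔ 3 ≤ (i : ℕ) := by
    intro i
    rw [Set.mem_compl_iff, ← not_lt, not_iff_not]
    exact ⟨by rintro ⟨j, rfl⟩; exact j.2, fun h ↦ ⟨⟨i, h⟩, rfl⟩⟩
  let κ := killCompl (R := k) e
  have hκs : Function.Surjective κ := fun p ↦ ⟨rename e p, killCompl_rename_app p⟩
  have hh' : κ h ∈ orderIdeal (Fin 3) k 3 := by
    obtain ⟨a, ha, b, hb, rfl⟩ := Submodule.mem_sup.1 hh
    have ha' : κ a = 0 := by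
      rw [← RingHom.mem_ker, ker_killCompl]
      refine Ideal.span_mono ?_ ha
      rintro _ ⟨i, hi, rfl⟩
      exact ⟨i, (hrange i).2 hi, rfl⟩
    rw [map_add, ha', zero_add]
    exact killCompl_mem_orderIdeal e (psMaxIdeal_pow_le_orderIdeal k _ 3 hb)
  let _ : Invertible (2 : k) := invertibleOfNonzero two_ne_zero
  obtain ⟨ψ, hψ⟩ := exists_algEquiv_sum_sq hh'
  set F : MvPowerSeries (Fin (m + 2 + 1)) k := X 0 ^ 2 + X 1 ^ 2 + X 2 ^ 2 + h with hF
  set q : MvPowerSeries (Fin 3) k := X 0 ^ 2 + X 1 ^ 2 + X 2 ^ 2 with hq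
  have hψq : ψ q = κ F := by
    have hX : ∀ i, κ (X (e i)) = X i := killCompl_X
    have h0 := hX 0
    have h1 := hX 1
    have h2 := hX 2
    rw [show e 0 = 0 from rfl] at h0
    rw [show e 1 = 1 from Fin.ext (by simp [e])] at h1
    rw [show e 2 = 2 from Fin.ext (by simp [e, Nat.mod_eq_of_lt])] at h2
    rw [Fin.sum_univ_three] at hψ
    rw [hq, hψ, hF]
    simp only [map_add, map_pow, h0, h1, h2]
  let J : Ideal (MvPowerSeries (Fin (m + 2 + 1)) k) := Ideal.span (X '' (Set.range e)ᶜ)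
  let g : Fin m → MvPowerSeries (Fin (m + 2 + 1)) k := fun j ↦ X (j.natAdd 3 |>.cast (by omega))
  have hJ : J = Ideal.span (Set.range g) := by
    refine congrArg Ideal.span (Set.ext fun p ↦ ?_)
    constructor
    · rintro ⟨i, hi, rfl⟩
      have hi := (hrange i).1 hi
      exact ⟨⟨i - 3, by omega⟩, congrArg X (Fin.ext (by simp; omega))⟩
    · rintro ⟨j, rfl⟩
      exact ⟨_, (hrange _).2 (by simp), rfl⟩
  let χ : MvPowerSeries (Fin (m + 2 + 1)) k →+* MvPowerSeries (Fin 3) k ⧸ Ideal.span {q} :=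
    (Ideal.Quotient.mk _).comp (ψ.symm.toRingEquiv.toRingHom.comp κ.toRingHom)
  have hχ : Function.Surjective χ :=
    Ideal.Quotient.mk_surjective.comp (ψ.symm.surjective.comp hκs)
  have hker : Ideal.span {F} ⊔ J = RingHom.ker χ := by
    have h1 : Ideal.span {F} ⊔ J = Ideal.comap κ (Ideal.span {κ F}) := by
      rw [← Set.image_singleton (f := κ) (a := F), ← Ideal.map_span, Ideal.comap_map_of_surjective κ hκs]
      exact congrArg _ (ker_killCompl e).symm
    rw [h1]
    ext f
    rw [Ideal.mem_comap, RingHom.mem_ker, ← hψq]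
    change _ ↔ Ideal.Quotient.mk _ (ψ.symm (κ f)) = 0
    rw [Ideal.Quotient.eq_zero_iff_mem, Ideal.mem_span_singleton, Ideal.mem_span_singleton,
      ← map_dvd_iff ψ (a := q), ψ.apply_symm_apply]
  refine ⟨fun j ↦ Ideal.Quotient.mk _ (g j), q, Or.inl ⟨1, le_rfl, hq⟩, ⟨?_⟩⟩
  have hmap : Ideal.span (Set.range fun j ↦ Ideal.Quotient.mk (Ideal.span {F}) (g j)) =
      J.map (Ideal.Quotient.mk (Ideal.span {F})) := by
    rw [hJ, Ideal.map_span, ← Set.range_comp]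
    rfl
  exact (Ideal.quotEquivOfEq hmap).trans <|
    (DoubleQuot.quotQuotEquivQuotSup _ _).trans <|
    (Ideal.quotEquivOfEq hker).trans (RingHom.quotientKerEquivOfSurjective hχ)
end
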